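/- If a semigroup X is projectively TzS-closed and projectively TzS-discrete, then the center Z(X) is periodic (every element of Z(X) has an idempotent power) and the set Z(X) ∩ √VE(X) is finite. -/

import Mathlib

universe u

open Set TopologicalSpace

/-- A topological space is zero-dimensional: it has a base of clopen sets. -/
def HasClopenBasis (Y : Type*) [TopologicalSpace Y] : Prop :=
  ∃ B : Set (Set Y), (∀ s ∈ B, IsClopen s) ∧ IsTopologicalBasis B

section TopClasses

variable (X : Type u) [Semigroup X]

/-- `X` is absolutely `T₁S`-closed: the image of every homomorphism to a `T₁`
topological semigroup is closed. -/
def AbsolutelyT1SClosed : Prop :=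
  ∀ (Y : Type u) [Semigroup Y] [TopologicalSpace Y] [ContinuousMul Y] [T1Space Y]
    (h : X →ₙ* Y), IsClosed (Set.range h)

/-- `X` is absolutely `T₂S`-closed. -/
def AbsolutelyT2SClosed : Prop :=
  ∀ (Y : Type u) [Semigroup Y] [TopologicalSpace Y] [ContinuousMul Y] [T2Space Y]
    (h : X →ₙ* Y), IsClosed (Set.range h)

/-- `X` is absolutely `TzS`-closed. -/
def AbsolutelyTzSClosed : Prop :=
  ∀ (Y : Type u) [Semigroup Y] [TopologicalSpace Y] [ContinuousMul Y] [T1Space Y],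
    HasClopenBasis Y → ∀ (h : X →ₙ* Y), IsClosed (Set.range h)

/-- `X` is `T₁S`-closed: the image of every injective homomorphism to a `T₁`
topological semigroup with discrete image is closed. -/
def T1SClosed : Prop :=
  ∀ (Y : Type u) [Semigroup Y] [TopologicalSpace Y] [ContinuousMul Y] [T1Space Y]
    (h : X →ₙ* Y), Function.Injective h → DiscreteTopology (Set.range h) →
      IsClosed (Set.range h)

/-- `X` is `T₂S`-closed. -/
def T2SClosed : Prop :=
  ∀ (Y : Type u) [Semigroup Y] [TopologicalSpace Y] [ContinuousMul Y] [T2Space Y]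
    (h : X →ₙ* Y), Function.Injective h → DiscreteTopology (Set.range h) →
      IsClosed (Set.range h)

/-- `X` is `TzS`-closed. -/
def TzSClosed : Prop :=
  ∀ (Y : Type u) [Semigroup Y] [TopologicalSpace Y] [ContinuousMul Y] [T1Space Y],
    HasClopenBasis Y → ∀ (h : X →ₙ* Y), Function.Injective h →
      DiscreteTopology (Set.range h) → IsClosed (Set.range h)

/-- `X` is injectively `T₂S`-closed. -/
def InjectivelyT2SClosed : Prop :=
  ∀ (Y : Type u) [Semigroup Y] [TopologicalSpace Y] [ContinuousMul Y] [T2Space Y]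
    (h : X →ₙ* Y), Function.Injective h → IsClosed (Set.range h)

/-- `X` is projectively `T₁S`-closed: all congruence quotients are `T₁S`-closed. -/
def ProjectivelyT1SClosed : Prop := ∀ c : Con X, T1SClosed c.Quotient

/-- `X` is projectively `TzS`-closed. -/
def ProjectivelyTzSClosed : Prop := ∀ c : Con X, TzSClosed c.Quotient

/-- `X` is projectively `T₁S`-discrete: every homomorphism into a `T₁`
topological semigroup has discrete image. -/
def ProjectivelyT1SDiscrete : Prop :=
  ∀ (Y : Type u) [Semigroup Y] [TopologicalSpace Y] [ContinuousMul Y] [T1Space Y]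
    (h : X →ₙ* Y), DiscreteTopology (Set.range h)

/-- `X` is projectively `TzS`-discrete. -/
def ProjectivelyTzSDiscrete : Prop :=
  ∀ (Y : Type u) [Semigroup Y] [TopologicalSpace Y] [ContinuousMul Y] [T1Space Y],
    HasClopenBasis Y → ∀ (h : X →ₙ* Y), DiscreteTopology (Set.range h)

end TopClasses

/-- `spow x n` is the power `x^(n+1)` in a semigroup; thus as `n` ranges over `ℕ`,
`spow x n` ranges over all powers `x^m`, `m ≥ 1`. -/
def spow {X : Type*} [Semigroup X] (x : X) : ℕ → X
  | 0 => x
  | n + 1 => spow x n * x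

section AlgDefs

variable (X : Type*) [Semigroup X]

/-- the set `E(X)` of idempotents. -/
def idemSet : Set X := {x | x * x = x}

/-- `H_e`, the maximal subgroup containing the idempotent `e`. -/
def maxSubgroup (e : X) : Set X :=
  {x | x * e = x ∧ e * x = x ∧ ∃ y, y * e = y ∧ e * y = y ∧ x * y = e ∧ y * x = e}

/-- The Clifford part `H(X) = ⋃_{e ∈ E(X)} H_e`. -/
def cliffordPart : Set X := ⋃ e ∈ idemSet X, maxSubgroup X e

/-- `H_e/e := {x : xe = ex ∈ H_e}`. -/
def HeCoideal (e : X) : Set X := {x | x * e = e * x ∧ x * e ∈ maxSubgroup X e}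

/-- `I` is an ideal of the semigroup `X`. -/
def IsIdealSet (I : Set X) : Prop := ∀ x ∈ I, ∀ y : X, x * y ∈ I ∧ y * x ∈ I

/-- The set `VE(X)` of viable idempotents: `e` is idempotent and `X ∖ (H_e/e)` is an ideal. -/
def viableIdems : Set X := {e | e ∈ idemSet X ∧ IsIdealSet X (Set.univ \ HeCoideal X e)}

/-- The center `Z(X)`. -/
def centerSet : Set X := {z | ∀ x, z * x = x * z}

/-- `√A = {x : xⁿ ∈ A for some n ≥ 1}`. -/
def sqrtSet (A : Set X) : Set X := {x | ∃ n : ℕ, spow x n ∈ A}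

/-- A subset `B ⊆ X` is bounded: there is `n ≥ 1` with `xⁿ` idempotent for all `x ∈ B`. -/
def BoundedSet (B : Set X) : Prop := ∃ n : ℕ, ∀ x ∈ B, spow x n ∈ idemSet X

/-- The semigroup `X` is bounded. -/
def BoundedSemigroup : Prop := ∃ n : ℕ, ∀ x : X, spow x n ∈ idemSet X

/-- `X` is chain-finite. -/
def ChainFinite : Prop :=
  ∀ I : Set X, I.Infinite → ∃ x ∈ I, ∃ y ∈ I, x * y ≠ x ∧ x * y ≠ y

/-- `G ⊆ X` is a subgroup of the semigroup `X`. -/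
def IsSubgroupSet (G : Set X) : Prop :=
  (∀ x ∈ G, ∀ y ∈ G, x * y ∈ G) ∧
    ∃ e ∈ G, (∀ x ∈ G, x * e = x ∧ e * x = x) ∧ ∀ x ∈ G, ∃ y ∈ G, x * y = e ∧ y * x = e

/-- `X` is group-finite: all its subgroups are finite. -/
def GroupFinite : Prop := ∀ G : Set X, IsSubgroupSet X G → G.Finite

/-- `X` is Clifford+finite: `X ∖ H(X)` is finite. -/
def CliffordPlusFinite : Prop := (Set.univ \ cliffordPart X).Finite

/-- `X` is `E`-commutative: idempotents commute. -/
def ECommutative : Prop := ∀ x ∈ idemSet X, ∀ y ∈ idemSet X, x * y = y * x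

end AlgDefs

/-- The Rees congruence associated with an ideal `I` of `X`. -/
def ReesCon {X : Type*} [Semigroup X] (I : Set X) (hI : IsIdealSet X I) : Con X where
  r x y := x = y ∨ (x ∈ I ∧ y ∈ I)
  iseqv :=
    { refl := fun _ => Or.inl rfl
      symm := by rintro x y (rfl | ⟨h1, h2⟩); exacts [Or.inl rfl, Or.inr ⟨h2, h1⟩]
      trans := by
        rintro x y z (rfl | ⟨h1, h2⟩) (rfl | ⟨h3, h4⟩)
        exacts [Or.inl rfl, Or.inr ⟨h3, h4⟩, Or.inr ⟨h1, h2⟩, Or.inr ⟨h1, h4⟩] }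
  mul' := by
    rintro a b c d (rfl | ⟨h1, h2⟩) (rfl | ⟨h3, h4⟩)
    · exact Or.inl rfl
    · exact Or.inr ⟨(hI c h3 a).2, (hI d h4 a).2⟩
    · exact Or.inr ⟨(hI a h1 c).1, (hI b h2 c).1⟩
    · exact Or.inr ⟨(hI a h1 c).1, (hI b h2 d).1⟩

/-- `X` is ideally `T₂S`-closed: all its Rees quotients are `T₂S`-closed. -/
def IdeallyT2SClosed (X : Type u) [Semigroup X] : Prop :=
  ∀ (I : Set X) (hI : IsIdealSet X I), T2SClosed (ReesCon I hI).Quotient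

/-- `X` is ideally `TzS`-closed. -/
def IdeallyTzSClosed (X : Type u) [Semigroup X] : Prop :=
  ∀ (I : Set X) (hI : IsIdealSet X I), TzSClosed (ReesCon I hI).Quotient

/-- A congruence is a semilattice congruence if its quotient is a commutative
semigroup of idempotents. -/
def IsSemilatticeCon {X : Type*} [Semigroup X] (c : Con X) : Prop :=
  (∀ a b : c.Quotient, a * b = b * a) ∧ ∀ a : c.Quotient, a * a = a

/-- The smallest semilattice congruence `⇕` on `X`, the intersection of all
semilattice congruences. -/
def slCon (X : Type*) [Semigroup X] : Con X := sInf {c | IsSemilatticeCon c}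

theorem centerSet_mul_mem {X : Type*} [Semigroup X] {a b : X}
    (ha : a ∈ centerSet X) (hb : b ∈ centerSet X) : a * b ∈ centerSet X := fun t => by
  rw [mul_assoc, hb t, ← mul_assoc, ha t, mul_assoc]

/-- The ideal center `IZ(X) = {z ∈ Z(X) : zX ⊆ Z(X)}`, as a subsemigroup of `X`. -/
def idealCenter (X : Type*) [Semigroup X] : Subsemigroup X where
  carrier := {z | z ∈ centerSet X ∧ ∀ x : X, z * x ∈ centerSet X}
  mul_mem' := by
    rintro a b ⟨ha, ha'⟩ ⟨hb, hb'⟩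
    refine ⟨centerSet_mul_mem ha hb, fun x => ?_⟩
    have h : a * b * x = a * (b * x) := mul_assoc a b x
    rw [h]
    exact centerSet_mul_mem ha (hb' x)

/-- Evaluation of the semigroup polynomial with coefficients `a, l = [a₁, …, aₙ]`:
`x ↦ a * x * a₁ * x * ⋯ * x * aₙ` (computed in `X¹ = WithOne X`). -/
def polyEval {X : Type*} [Semigroup X] (a : WithOne X) (l : List (WithOne X)) (x : X) :
    WithOne X :=
  l.foldl (fun acc b => acc * (x : WithOne X) * b) a

/-- `f : X → X¹` is a semigroup polynomial of degree `d ≥ 1`. -/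
def IsSemigroupPolynomial {X : Type*} [Semigroup X] (f : X → WithOne X) (d : ℕ) : Prop :=
  1 ≤ d ∧ ∃ (a : WithOne X) (l : List (WithOne X)), l.length = d ∧ ∀ x, f x = polyEval a l x

/-- `X` is polybounded. -/
def Polybounded (X : Type*) [Semigroup X] : Prop :=
  ∃ (k : ℕ) (f : Fin k → X → WithOne X) (d : Fin k → ℕ) (b : Fin k → X),
    (∀ i, IsSemigroupPolynomial (f i) (d i)) ∧ ∀ x : X, ∃ i, f i x = (b i : WithOne X)

/-- `X` is polyfinite. -/
def Polyfinite (X : Type*) [Semigroup X] : Prop :=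
  ∃ (d : ℕ) (F : Set X), F.Finite ∧ ∀ x y : X,
    ∃ (f : X → WithOne X) (m : ℕ), m ≤ d ∧ IsSemigroupPolynomial f m ∧
      (∃ u ∈ F, f x = (u : WithOne X)) ∧ ∃ v ∈ F, f y = (v : WithOne X)

/-- `X` is `B`-centrobounded over `B ⊆ E(X)`: there is `n ≥ 1` such that for every
`e ∈ B` and all `x, y ∈ ⋂_{a ∈ B} H_a/a`, if `w` is the inverse of `y*e` in the group
`H_e` and `(x*e)*w ∈ H_e ∩ Z(X)`, then `((x*e)*w)ⁿ` is an idempotent. -/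
def Centrobounded {X : Type*} [Semigroup X] (B : Set X) : Prop :=
  ∃ n : ℕ, ∀ e ∈ B, ∀ x ∈ ⋂ a ∈ B, HeCoideal X a, ∀ y ∈ ⋂ a ∈ B, HeCoideal X a,
    ∀ w ∈ maxSubgroup X e, (y * e) * w = e → w * (y * e) = e →
      (x * e) * w ∈ maxSubgroup X e → (x * e) * w ∈ centerSet X →
        spow ((x * e) * w) n ∈ idemSet X

/-- `B` is an antichain in the natural partial order `e ≤ f ⇔ ef = fe = e` on idempotents. -/
def IsIdemAntichain {X : Type*} [Semigroup X] (B : Set X) : Prop :=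
  ∀ e ∈ B, ∀ f ∈ B, e ≠ f → ¬(e * f = e ∧ f * e = e) ∧ ¬(e * f = f ∧ f * e = f)

section ClopenBasis

theorem hasClopenBasis_of_forall_exists {Y : Type*} [TopologicalSpace Y]
    (h : ∀ (x : Y) (U : Set Y), IsOpen U → x ∈ U → ∃ V, IsClopen V ∧ x ∈ V ∧ V ⊆ U) :
    HasClopenBasis Y :=
  ⟨{s | IsClopen s}, fun _ hs => hs, isTopologicalBasis_of_isOpen_of_nhds (fun _ hs => hs.isOpen)
    fun x U hx hU => h x U hU hx⟩

theorem HasClopenBasis.exists_isClopen {Y : Type*} [TopologicalSpace Y] (h : HasClopenBasis Y)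
    {x : Y} {U : Set Y} (hU : IsOpen U) (hx : x ∈ U) : ∃ V, IsClopen V ∧ x ∈ V ∧ V ⊆ U := by
  obtain ⟨B, hB, hbasis⟩ := h
  obtain ⟨V, hV, hxV, hVU⟩ := hbasis.exists_subset_of_mem_open hx hU
  exact ⟨V, hB V hV, hxV, hVU⟩

theorem hasClopenBasis_of_discrete (Y : Type*) [TopologicalSpace Y] [DiscreteTopology Y] :
    HasClopenBasis Y :=
  hasClopenBasis_of_forall_exists fun _ U _ hx => ⟨U, isClopen_discrete U, hx, Subset.rfl⟩

theorem HasClopenBasis.of_isInducing {Y Z : Type*} [TopologicalSpace Y] [TopologicalSpace Z]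
    (h : HasClopenBasis Z) {f : Y → Z} (hf : Topology.IsInducing f) : HasClopenBasis Y := by
  refine hasClopenBasis_of_forall_exists fun x U hU hx => ?_
  obtain ⟨U', hU', rfl⟩ := hf.isOpen_iff.1 hU
  obtain ⟨V, hV, hxV, hVU⟩ := h.exists_isClopen hU' hx
  exact ⟨f ⁻¹' V, hV.preimage hf.continuous, hxV, preimage_mono hVU⟩

theorem HasClopenBasis.prod {Y Z : Type*} [TopologicalSpace Y] [TopologicalSpace Z]
    (hY : HasClopenBasis Y) (hZ : HasClopenBasis Z) : HasClopenBasis (Y × Z) := by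
  refine hasClopenBasis_of_forall_exists fun x U hU hx => ?_
  obtain ⟨V, W, hV, hW, hxV, hxW, hVW⟩ := isOpen_prod_iff.1 hU x.1 x.2 hx
  obtain ⟨V', hV', hxV', hVV'⟩ := hY.exists_isClopen hV hxV
  obtain ⟨W', hW', hxW', hWW'⟩ := hZ.exists_isClopen hW hxW
  exact ⟨V' ×ˢ W', hV'.prod hW', ⟨hxV', hxW'⟩, (prod_mono hVV' hWW').trans hVW⟩

theorem HasClopenBasis.pi {ι : Type*} {Y : ι → Type*} [∀ i, TopologicalSpace (Y i)]
    (h : ∀ i, HasClopenBasis (Y i)) : HasClopenBasis (∀ i, Y i) := by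
  refine hasClopenBasis_of_forall_exists fun x U hU hx => ?_
  obtain ⟨I, u, hu, hIU⟩ := isOpen_pi_iff.1 hU x hx
  choose! V hV using fun i (hi : i ∈ I) => (h i).exists_isClopen (hu i hi).1 (hu i hi).2
  refine ⟨(I : Set ι).pi V, ⟨isClosed_set_pi fun i hi => (hV i hi).1.isClosed,
    isOpen_set_pi I.finite_toSet fun i hi => (hV i hi).1.isOpen⟩,
    fun i hi => (hV i hi).2.1, (pi_mono fun i hi => (hV i hi).2.2).trans hIU⟩

theorem hasClopenBasis_of_countable (Y : Type*) [MetricSpace Y] [Countable Y] :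
    HasClopenBasis Y := by
  refine hasClopenBasis_of_forall_exists fun x U hU hx => ?_
  obtain ⟨ε, hε, hball⟩ := Metric.isOpen_iff.1 hU x hx
  obtain ⟨r, hr, hr0, hrε⟩ := ((countable_range fun y => dist y x).dense_compl ℝ).exists_between hε
  have hEq : Metric.ball x r = Metric.closedBall x r := by
    ext y
    simp only [Metric.mem_ball, Metric.mem_closedBall]
    exact ⟨le_of_lt, fun hy => lt_of_le_of_ne hy fun h => hr ⟨y, h⟩⟩
  exact ⟨Metric.ball x r, ⟨hEq ▸ Metric.isClosed_closedBall, Metric.isOpen_ball⟩,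
    Metric.mem_ball_self hr0, (Metric.ball_subset_ball hrε.le).trans hball⟩

theorem Ultrafilter.hasClopenBasis (S : Type*) : HasClopenBasis (Ultrafilter S) := by
  refine ⟨ultrafilterBasis S, ?_, ultrafilterBasis_is_basis⟩
  rintro _ ⟨s, rfl⟩
  exact ⟨ultrafilter_isClosed_basic s, ultrafilter_isOpen_basic s⟩

end ClopenBasis

/-- Every homomorphic image of `X` in a zero-dimensional `T₁` topological semigroup is closed
and discrete. -/
def HasClosedDiscreteImages (X : Type u) [Semigroup X] : Prop :=
  ∀ (Y : Type u) [Semigroup Y] [TopologicalSpace Y] [ContinuousMul Y] [T1Space Y],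
    HasClopenBasis Y → ∀ h : X →ₙ* Y, IsClosed (range h) ∧ DiscreteTopology (range h)

section Images

variable {X : Type u} [Semigroup X]

theorem hasClosedDiscreteImages_of_projectively (h1 : ProjectivelyTzSClosed X)
    (h2 : ProjectivelyTzSDiscrete X) : HasClosedDiscreteImages X := by
  intro Y _ _ _ _ hY h
  refine ⟨?_, h2 Y hY h⟩
  let k : (Con.ker h).Quotient →ₙ* Y :=
    { toFun := fun q => Con.liftOn q h fun _ _ hab => hab
      map_mul' := by
        intro p q
        induction p, q using Con.induction_on₂ with
        | _ a b => exact map_mul h a b }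
  have hk : range k = range h := by
    ext y
    constructor
    · rintro ⟨q, rfl⟩
      induction q using Con.induction_on with
      | _ a => exact ⟨a, rfl⟩
    · rintro ⟨a, rfl⟩
      exact ⟨(a : (Con.ker h).Quotient), rfl⟩
  have hinj : Function.Injective k := by
    intro p q
    induction p, q using Con.induction_on₂ with
    | _ a b => exact fun hab => (Con.eq _).2 hab
  rw [← hk]
  exact h1 (Con.ker h) Y hY k hinj (hk ▸ h2 Y hY h)

theorem HasClosedDiscreteImages.quotient (hX : HasClosedDiscreteImages X) (c : Con X) :
    HasClosedDiscreteImages c.Quotient := by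
  intro Y _ _ _ _ hY h
  have hr : range (h.comp c.mkMulHom) = range h := by
    rw [MulHom.coe_comp]
    have hs : Function.Surjective c.mkMulHom := fun q =>
      Con.induction_on q fun a => ⟨a, rfl⟩
    exact hs.range_comp h
  exact hr ▸ hX Y hY (h.comp c.mkMulHom)

theorem WithOne.coe_mul_comm_of_mem_centerSet {z : X} (hz : z ∈ centerSet X) (w : WithOne X) :
    (z : WithOne X) * w = w * z := by
  refine WithOne.cases_on w (by simp) fun x => ?_
  rw [← WithOne.coe_mul, hz x, WithOne.coe_mul]

attribute [local instance] Ultrafilter.semigroup in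
/-- In a semigroup with closed discrete images, central sets with a constant product are finite. -/
theorem HasClosedDiscreteImages.finite_of_mul_eq (hX : HasClosedDiscreteImages X) {B : Set X}
    (hB : B ⊆ centerSet X) (c : X) (hc : ∀ a ∈ B, ∀ b ∈ B, a * b = c) : B.Finite := by
  by_contra hinf
  let T : WithOne X → Set X := fun w => {y | ∃ b ∈ B, (y : WithOne X) = w * b}
  have hTT : ∀ w v, ∀ x ∈ T w, ∀ y ∈ T v, ((x * y : X) : WithOne X) = w * v * c := by
    rintro w v x ⟨a, ha, hx⟩ y ⟨b, hb, hy⟩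
    rw [WithOne.coe_mul, hx, hy, ← hc a ha b hb, WithOne.coe_mul, mul_assoc w,
      ← mul_assoc (a : WithOne X), WithOne.coe_mul_comm_of_mem_centerSet (hB ha) v]
    simp only [mul_assoc]
  have mem_mul : ∀ (V W : Ultrafilter X) (s : Set X),
      s ∈ V * W ↔ {m | {m' | m * m' ∈ s} ∈ W} ∈ V := fun V W s => Iff.rfl
  have key : ∀ w v, ∀ x ∈ T w, ∀ y ∈ T v, ∀ V W : Ultrafilter X, T w ∈ V → T v ∈ W →
      V * W = pure (x * y) := by
    intro w v x hx y hy V W hV hW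
    have hs : {x * y} ∈ V * W := by
      rw [mem_mul]
      filter_upwards [hV] with x' hx'
      filter_upwards [hW] with y' hy'
      exact WithOne.coe_injective ((hTT w v x' hx' y' hy').trans (hTT w v x hx y hy).symm)
    exact Ultrafilter.eq_of_le (by simpa using hs)
  have pure_mul_pure : ∀ x y : X, (pure (x * y) : Ultrafilter X) = pure x * pure y :=
    fun x y => Ultrafilter.ext fun s => by simp [mem_mul]
  have T_left : ∀ (x : X) w (V : Ultrafilter X), T w ∈ V → T (x * w) ∈ pure x * V := by
    intro x w V hV
    rw [mem_mul, Ultrafilter.mem_pure]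
    filter_upwards [hV]
    rintro y ⟨b, hb, hy⟩
    exact ⟨b, hb, by rw [WithOne.coe_mul, hy, mul_assoc]⟩
  have T_right : ∀ (x : X) w (V : Ultrafilter X), T w ∈ V → T (w * x) ∈ V * pure x := by
    intro x w V hV
    rw [mem_mul]
    filter_upwards [hV]
    rintro y ⟨b, hb, hy⟩
    refine Ultrafilter.mem_pure.2 ⟨b, hb, ?_⟩
    rw [WithOne.coe_mul, hy, mul_assoc, mul_assoc, WithOne.coe_mul_comm_of_mem_centerSet (hB hb)]
  let Y : Subsemigroup (Ultrafilter X) :=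
    { carrier := {V | (∃ x, V = pure x) ∨ ∃ w, T w ∈ V}
      mul_mem' := by
        rintro V W (⟨x, rfl⟩ | ⟨w, hw⟩) (⟨y, rfl⟩ | ⟨v, hv⟩)
        · exact Or.inl ⟨x * y, (pure_mul_pure x y).symm⟩
        · exact Or.inr ⟨_, T_left x v W hv⟩
        · exact Or.inr ⟨_, T_right y w V hw⟩
        · obtain ⟨x, hx⟩ := Ultrafilter.nonempty_of_mem hw
          obtain ⟨y, hy⟩ := Ultrafilter.nonempty_of_mem hv
          exact Or.inl ⟨_, key w v x hx y hy V W hw hv⟩ }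
  have nhds_of_mem : ∀ (s : Set X) (V : Ultrafilter X), s ∈ V → ∀ᶠ U in nhds V, s ∈ U :=
    fun s V hs => (ultrafilter_isOpen_basic s).mem_nhds hs
  have cont_left : ∀ x : X, Continuous fun V : Ultrafilter X => pure x * V := fun x =>
    ultrafilterBasis_is_basis.continuous_iff.2 <| forall_mem_range.2 fun s =>
      ultrafilter_isOpen_basic {y | x * y ∈ s}
  have eq_pure : ∀ (x : X) (V : Ultrafilter X), {x} ∈ V → V = pure x := fun x V hV =>
    Ultrafilter.eq_of_le (by simpa using hV)
  have hcont : ∀ p ∈ (Y : Set (Ultrafilter X)) ×ˢ (Y : Set (Ultrafilter X)),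
      ContinuousAt (fun q : Ultrafilter X × Ultrafilter X => q.1 * q.2) p := by
    rintro ⟨V, W⟩ ⟨⟨x, rfl⟩ | ⟨w, hw⟩, hW⟩
    · refine ((cont_left x).comp continuous_snd).continuousAt.congr ?_
      filter_upwards [continuousAt_fst.eventually (nhds_of_mem {x} (pure x) (by simp))] with q hq
      simp [eq_pure x q.1 hq]
    obtain ⟨y, rfl⟩ | ⟨v, hv⟩ := hW
    · refine ((Ultrafilter.continuous_mul_left (pure y)).comp continuous_fst).continuousAt.congr ?_
      filter_upwards [continuousAt_snd.eventually (nhds_of_mem {y} (pure y) (by simp))] with q hq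
      simp [eq_pure y q.2 hq]
    · obtain ⟨x, hx⟩ := Ultrafilter.nonempty_of_mem hw
      obtain ⟨y, hy⟩ := Ultrafilter.nonempty_of_mem hv
      refine (continuousAt_const (y := (pure (x * y) : Ultrafilter X))).congr ?_
      filter_upwards [continuousAt_fst.eventually (nhds_of_mem _ V hw),
        continuousAt_snd.eventually (nhds_of_mem _ W hv)] with q hq hq'
      exact (key w v x hx y hy q.1 q.2 hq hq').symm
  have : ContinuousMul Y := by
    refine ⟨continuous_iff_continuousAt.2 fun p => ?_⟩
    refine Topology.IsInducing.subtypeVal.continuousAt_iff.2 ?_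
    exact ContinuousAt.comp (f := fun p : Y × Y => ((p.1 : Ultrafilter X), (p.2 : Ultrafilter X)))
      (hcont (p.1, p.2) ⟨p.1.2, p.2.2⟩) (by fun_prop)
  let h : X →ₙ* Y :=
    { toFun := fun x => ⟨pure x, Or.inl ⟨x, rfl⟩⟩
      map_mul' := fun x y => Subtype.ext (pure_mul_pure x y) }
  obtain ⟨hclosed, -⟩ := hX Y
    ((Ultrafilter.hasClopenBasis X).of_isInducing Topology.IsInducing.subtypeVal) h
  have : Filter.NeBot (Filter.cofinite ⊓ Filter.principal B) :=
    Set.Infinite.cofinite_inf_principal_neBot hinf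
  obtain ⟨U, hU⟩ := Ultrafilter.exists_le (Filter.cofinite ⊓ Filter.principal B)
  have hUB : B ∈ U := hU (Filter.mem_inf_of_right (Filter.mem_principal_self B))
  have hUY : U ∈ Y := Or.inr ⟨1, by
    filter_upwards [hUB] with b hb
    exact ⟨b, hb, (one_mul _).symm⟩⟩
  have hmem : (⟨U, hUY⟩ : Y) ∈ closure (range h) := by
    rw [Topology.IsInducing.subtypeVal.closure_eq_preimage_closure_image, mem_preimage,
      ← range_comp]
    exact denseRange_pure U
  rw [hclosed.closure_eq] at hmem
  obtain ⟨x, hx⟩ := hmem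
  have hxU : U = pure x := (congrArg Subtype.val hx).symm
  have hx' : ({x}ᶜ : Set X) ∈ U :=
    hU (Filter.mem_inf_of_left (Set.finite_singleton x).compl_mem_cofinite)
  simp [hxU] at hx'

end Images

theorem WithOne.coe_spow {X : Type*} [Semigroup X] (x : X) (n : ℕ) :
    ((spow x n : X) : WithOne X) = (x : WithOne X) ^ (n + 1) := by
  induction n with
  | zero => simp [spow]
  | succ n ih => rw [spow, WithOne.coe_mul, ih, ← pow_succ]

section Periodic

variable {X : Type u} [Semigroup X]

/-- The congruence on `X` making the central element `z` invertible with trivial `n`-th power. -/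
def centralPowCon (z : X) (hz : z ∈ centerSet X) (n : ℕ) : Con X where
  r x y := ∃ a b : ℕ, a ≡ b [MOD n] ∧ (z : WithOne X) ^ a * x = (z : WithOne X) ^ b * y
  iseqv :=
    { refl := fun _ => ⟨0, 0, rfl, rfl⟩
      symm := fun ⟨a, b, hab, h⟩ => ⟨b, a, hab.symm, h.symm⟩
      trans := by
        rintro x y t ⟨a, b, hab, h⟩ ⟨c, d, hcd, h'⟩
        refine ⟨c + a, b + d, (hcd.add hab).trans (by rw [add_comm]), ?_⟩
        rw [pow_add, mul_assoc, h, ← mul_assoc, ← pow_add, add_comm c b, pow_add, mul_assoc, h',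
          ← mul_assoc, ← pow_add] }
  mul' := by
    rintro x y x' y' ⟨a, b, hab, h⟩ ⟨c, d, hcd, h'⟩
    have hcomm : ∀ (k : ℕ) (w : WithOne X), (z : WithOne X) ^ k * w = w * (z : WithOne X) ^ k :=
      fun k w => (show Commute (z : WithOne X) w from
        WithOne.coe_mul_comm_of_mem_centerSet hz w).pow_left k
    refine ⟨a + c, b + d, hab.add hcd, ?_⟩
    have expand : ∀ (k l : ℕ) (u v : X), (z : WithOne X) ^ (k + l) * ((u * v : X) : WithOne X) =
        ((z : WithOne X) ^ k * u) * ((z : WithOne X) ^ l * v) := fun k l u v => by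
      rw [WithOne.coe_mul, pow_add, mul_assoc, mul_assoc, ← mul_assoc _ (u : WithOne X),
        hcomm l u, mul_assoc]
    rw [expand, expand, h, h']

theorem exists_spow_mem_idemSet_of_pow_eq (z : X) {a b : ℕ} (ha : 0 < a) (hab : a < b)
    (h : (z : WithOne X) ^ a = (z : WithOne X) ^ b) : ∃ n, spow z n ∈ idemSet X := by
  obtain ⟨d, rfl⟩ := Nat.exists_eq_add_of_lt hab
  have hj : ∀ j : ℕ, (z : WithOne X) ^ (a + j * (d + 1)) = (z : WithOne X) ^ a := by
    intro j
    induction j with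
    | zero => simp
    | succ j ih =>
      rw [show a + (j + 1) * (d + 1) = (a + d + 1) + j * (d + 1) by ring, pow_add, ← h, ← pow_add,
        ih]
  refine ⟨a * (d + 1) - 1, WithOne.coe_injective ?_⟩
  have hpos : 0 < a * (d + 1) := by positivity
  rw [WithOne.coe_mul, WithOne.coe_spow, Nat.sub_add_cancel hpos, ← pow_add]
  have h2 := hj a
  rw [show a * (d + 1) + a * (d + 1) = (a + a * (d + 1)) + a * d by ring, pow_add, h2, ← pow_add]
  congr 1
  ring

theorem HasClosedDiscreteImages.exists_spow_mem_idemSet (hX : HasClosedDiscreteImages X) {z : X}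
    (hz : z ∈ centerSet X) : ∃ n, spow z n ∈ idemSet X := by
  by_contra hno
  have hinj : ∀ a b : ℕ, 0 < a → 0 < b → (z : WithOne X) ^ a = (z : WithOne X) ^ b → a = b := by
    intro a b ha hb h
    rcases lt_trichotomy a b with hab | hab | hab
    · exact absurd (exists_spow_mem_idemSet_of_pow_eq z ha hab h) hno
    · exact hab
    · exact absurd (exists_spow_mem_idemSet_of_pow_eq z hb hab h.symm) hno
  let c : ℕ → Con X := fun n => centralPowCon z hz (n + 1)
  let _ : ∀ n, TopologicalSpace (c n).Quotient := fun n => ⊥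
  have _ : ∀ n, DiscreteTopology (c n).Quotient := fun n => ⟨rfl⟩
  let h : X →ₙ* (∀ n, (c n).Quotient) :=
    { toFun := fun x n => (x : (c n).Quotient)
      map_mul' := fun x y => rfl }
  obtain ⟨hclosed, hdisc⟩ := hX _
    (HasClopenBasis.pi fun n => hasClopenBasis_of_discrete (c n).Quotient) h
  let u : ∀ n, (c n).Quotient := fun n => ((spow z n : X) : (c n).Quotient)
  have hx : ∀ k : ℕ, ((spow z (k.factorial - 1) : X) : WithOne X) = (z : WithOne X) ^ k.factorial :=
    fun k => by rw [WithOne.coe_spow, Nat.sub_add_cancel k.factorial_pos]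
  have htend :
      Filter.Tendsto (fun k : ℕ => h (spow z (k.factorial - 1))) Filter.atTop (nhds u) := by
    refine tendsto_pi_nhds.2 fun n => tendsto_nhds_of_eventually_eq ?_
    filter_upwards [Filter.eventually_ge_atTop (n + 1)] with k hk
    refine (Con.eq (c n)).2 ⟨n + 1, k.factorial, ?_, ?_⟩
    · exact ((Nat.modEq_zero_iff_dvd.2 dvd_rfl).trans
        (Nat.modEq_zero_iff_dvd.2 (Nat.dvd_factorial n.succ_pos hk)).symm)
    · rw [hx, WithOne.coe_spow, ← pow_add, ← pow_add, add_comm]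
  have hu : u ∈ range h :=
    hclosed.mem_of_tendsto htend (Filter.Eventually.of_forall fun k => ⟨_, rfl⟩)
  obtain ⟨V, hV, hVu⟩ := isOpen_induced_iff.1 (isOpen_discrete ({⟨u, hu⟩} : Set (range h)))
  have huV : u ∈ V := by
    have : (⟨u, hu⟩ : range h) ∈ Subtype.val ⁻¹' V := hVu ▸ rfl
    exact this
  obtain ⟨k, hk⟩ := (htend.eventually (hV.mem_nhds huV)).exists
  have hku : h (spow z (k.factorial - 1)) = u := by
    have : (⟨_, ⟨_, rfl⟩⟩ : range h) ∈ Subtype.val ⁻¹' V := hk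
    rw [hVu] at this
    exact congrArg Subtype.val this
  obtain ⟨a, b, hab, heq⟩ := (Con.eq (c k.factorial)).1 (congrFun hku k.factorial)
  rw [hx, WithOne.coe_spow, ← pow_add, ← pow_add] at heq
  have := hinj _ _ (by have := k.factorial_pos; omega) (by omega) heq
  obtain rfl : a = b + 1 := by omega
  have h1 := (Nat.modEq_iff_dvd' (by omega : b ≤ b + 1)).1 hab.symm
  have := k.factorial_pos
  have := Nat.le_of_dvd (by omega) h1
  omega

end Periodic

section Nil

variable {X : Type u} [Semigroup X]

/-- The set `zX¹` of right multiples of `z`. -/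
def rightMultiples (z : X) : Set X := {y | ∃ w : WithOne X, (y : WithOne X) = z * w}

theorem mem_rightMultiples_self (z : X) : z ∈ rightMultiples z := ⟨1, (mul_one _).symm⟩

theorem mem_rightMultiples_trans {x y z : X} (hxy : x ∈ rightMultiples y)
    (hyz : y ∈ rightMultiples z) : x ∈ rightMultiples z := by
  obtain ⟨w, hw⟩ := hxy
  obtain ⟨v, hv⟩ := hyz
  exact ⟨v * w, by rw [hw, hv, mul_assoc]⟩

theorem isIdealSet_rightMultiples {z : X} (hz : z ∈ centerSet X) :
    IsIdealSet X (rightMultiples z) := by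
  rintro x ⟨w, hw⟩ y
  refine ⟨⟨w * y, by rw [WithOne.coe_mul, hw, mul_assoc]⟩, ⟨y * w, ?_⟩⟩
  rw [WithOne.coe_mul, hw, ← mul_assoc, ← WithOne.coe_mul_comm_of_mem_centerSet hz, mul_assoc]

theorem IsIdealSet.union {I J : Set X} (hI : IsIdealSet X I) (hJ : IsIdealSet X J) :
    IsIdealSet X (I ∪ J) := by
  rintro x (hx | hx) y
  · exact ⟨Or.inl (hI x hx y).1, Or.inl (hI x hx y).2⟩
  · exact ⟨Or.inr (hJ x hx y).1, Or.inr (hJ x hx y).2⟩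

theorem IsIdealSet.mem_of_mem_rightMultiples {J : Set X} (hJ : IsIdealSet X J) {x y : X}
    (hx : x ∈ J) (hy : y ∈ rightMultiples x) : y ∈ J := by
  obtain ⟨w, hw⟩ := hy
  revert hw
  refine WithOne.cases_on w (fun hw => ?_) fun v hw => ?_
  · rw [mul_one] at hw
    exact WithOne.coe_injective hw ▸ hx
  · rw [← WithOne.coe_mul] at hw
    exact WithOne.coe_injective hw ▸ (hJ x hx v).1

theorem HasClosedDiscreteImages.finite_diff_of_mul_mem (hX : HasClosedDiscreteImages X)
    {B L : Set X} (hB : B ⊆ centerSet X) (hL : IsIdealSet X L)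
    (hBL : ∀ a ∈ B, ∀ b ∈ B, a * b ∈ L) : (B \ L).Finite := by
  rcases (B \ L).eq_empty_or_nonempty with h | ⟨b₀, hb₀, -⟩
  · simp [h]
  let c := ReesCon L hL
  let q : X → c.Quotient := fun x => (x : c.Quotient)
  have hfin : (q '' (B \ L)).Finite := by
    refine (hX.quotient c).finite_of_mul_eq ?_ (q (b₀ * b₀)) ?_
    · rintro _ ⟨b, hb, rfl⟩ t
      induction t using Con.induction_on with
      | _ t => exact congrArg q (hB hb.1 t)
    · rintro _ ⟨a, ha, rfl⟩ _ ⟨b, hb, rfl⟩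
      exact (Con.eq c).2 (Or.inr ⟨hBL a ha.1 b hb.1, hBL b₀ hb₀ b₀ hb₀⟩)
  refine Set.Finite.of_finite_image hfin fun a ha b hb hab => ?_
  rcases (Con.eq c).1 hab with h | h
  · exact h
  · exact absurd h.1 ha.2

theorem HasClosedDiscreteImages.finite_rightMultiples_diff (hX : HasClosedDiscreteImages X)
    {J : Set X} (hJ : IsIdealSet X J) (n : ℕ) {z : X} (hz : z ∈ centerSet X)
    (hzn : spow z n ∈ J) : ((rightMultiples z ∩ centerSet X) \ J).Finite := by
  induction n generalizing z with
  | zero =>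
    convert Set.finite_empty (α := X)
    exact eq_empty_of_forall_notMem fun y hy =>
      hy.2 (hJ.mem_of_mem_rightMultiples hzn hy.1.1)
  | succ n ih =>
    have hzz : z * z ∈ centerSet X := centerSet_mul_mem hz hz
    have hpow : spow (z * z) n ∈ J := by
      refine hJ.mem_of_mem_rightMultiples hzn ⟨(z : WithOne X) ^ n, ?_⟩
      rw [WithOne.coe_spow, WithOne.coe_spow, WithOne.coe_mul, ← pow_two, ← pow_mul, ← pow_add]
      congr 1
      ring
    have hfin := hX.finite_diff_of_mul_mem (B := rightMultiples z ∩ centerSet X)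
      inter_subset_right ((isIdealSet_rightMultiples hzz).union hJ) (by
        rintro a ⟨⟨v, hv⟩, -⟩ b ⟨⟨w, hw⟩, -⟩
        refine Or.inl ⟨v * w, ?_⟩
        rw [WithOne.coe_mul, WithOne.coe_mul, hv, hw, mul_assoc, ← mul_assoc v,
          ← WithOne.coe_mul_comm_of_mem_centerSet hz]
        simp only [mul_assoc])
    refine (hfin.union (ih hzz hpow)).subset fun y hy => ?_
    by_cases hyz : y ∈ rightMultiples (z * z)
    · exact Or.inr ⟨⟨hyz, hy.1.2⟩, hy.2⟩
    · exact Or.inl ⟨hy.1, fun h => h.elim hyz hy.2⟩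

theorem HasClosedDiscreteImages.finite_central_radical_diff (hX : HasClosedDiscreteImages X)
    {J : Set X} (hJ : IsIdealSet X J) :
    ((centerSet X ∩ sqrtSet X J) \ J).Finite := by
  let N : Set X := centerSet X ∩ sqrtSet X J
  let P : Set X := {y | ∃ a ∈ N, ∃ b ∈ N, y ∈ rightMultiples (a * b)}
  have hP : IsIdealSet X P := by
    rintro x ⟨a, ha, b, hb, h⟩ y
    have := isIdealSet_rightMultiples (centerSet_mul_mem ha.1 hb.1) x h y
    exact ⟨⟨a, ha, b, hb, this.1⟩, ⟨a, ha, b, hb, this.2⟩⟩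
  have hD : (N \ (P ∪ J)).Finite := hX.finite_diff_of_mul_mem inter_subset_left (hP.union hJ)
    fun a ha b hb => Or.inl ⟨a, ha, b, hb, mem_rightMultiples_self _⟩
  let F : Set X := ⋃ d ∈ N \ (P ∪ J), (rightMultiples d ∩ centerSet X) \ J
  have hF : F.Finite := hD.biUnion fun d hd => by
    obtain ⟨n, hn⟩ := hd.1.2
    exact hX.finite_rightMultiples_diff hJ n hd.1.1 hn
  suffices h : N \ J ⊆ F from hF.subset h
  by_contra hsub
  obtain ⟨x, hx, hxF⟩ := not_subset.1 hsub
  have hsplit : ∀ y ∈ (N \ J) \ F, ∃ a ∈ (N \ J) \ F, ∃ b ∈ (N \ J) \ F,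
      y ∈ rightMultiples (a * b) := by
    rintro y ⟨⟨hyN, hyJ⟩, hyF⟩
    have hyP : y ∈ P := by
      by_contra hyP
      exact hyF (mem_biUnion (x := y) ⟨hyN, fun h => h.elim hyP hyJ⟩
        ⟨⟨mem_rightMultiples_self y, hyN.1⟩, hyJ⟩)
    obtain ⟨a, ha, b, hb, hab⟩ := hyP
    have factor : ∀ c ∈ N, y ∈ rightMultiples c → c ∈ (N \ J) \ F := by
      intro c hc hyc
      refine ⟨⟨hc, fun h => hyJ (hJ.mem_of_mem_rightMultiples h hyc)⟩, fun h => hyF ?_⟩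
      obtain ⟨d, hd, hcd⟩ := mem_iUnion₂.1 h
      exact mem_biUnion hd ⟨⟨mem_rightMultiples_trans hyc hcd.1.1, hyN.1⟩, hyJ⟩
    have haab : a * b ∈ rightMultiples a := ⟨b, WithOne.coe_mul a b⟩
    have hbab : a * b ∈ rightMultiples b := ⟨a, by rw [ha.1 b, WithOne.coe_mul]⟩
    exact ⟨a, factor a ha (mem_rightMultiples_trans hab haab), b,
      factor b hb (mem_rightMultiples_trans hab hbab), hab⟩
  obtain ⟨a, ha, b, hb, hab⟩ := hsplit x ⟨hx, hxF⟩
  let T : Set X := {y | y ∈ (rightMultiples a ∩ centerSet X) \ J ∧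
    ∃ m ∈ (N \ J) \ F, x ∈ rightMultiples (y * m)}
  have hT : T.Finite := by
    obtain ⟨n, hn⟩ := ha.1.1.2
    exact (hX.finite_rightMultiples_diff hJ n ha.1.1.1 hn).subset fun y hy => hy.1
  obtain ⟨y, ⟨⟨⟨hya, hyZ⟩, hyJ⟩, m, hm, hxm⟩, hmin⟩ := hT.exists_minimalFor rightMultiples T
    ⟨a, ⟨⟨mem_rightMultiples_self a, ha.1.1.1⟩, ha.1.2⟩, b, hb, hab⟩
  obtain ⟨p, hp, r, hr, hm'⟩ := hsplit m hm
  have hyp : y * p ∈ rightMultiples y := ⟨p, WithOne.coe_mul y p⟩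
  have hxp : x ∈ rightMultiples (y * p * r) := by
    obtain ⟨w, hw⟩ := hm'
    refine mem_rightMultiples_trans hxm ⟨w, ?_⟩
    rw [WithOne.coe_mul y m, hw]
    simp only [WithOne.coe_mul, mul_assoc]
  have hypT : y * p ∈ T := by
    refine ⟨⟨⟨mem_rightMultiples_trans hyp hya, centerSet_mul_mem hyZ hp.1.1.1⟩, fun h => ?_⟩,
      r, hr, hxp⟩
    exact hx.2 (hJ.mem_of_mem_rightMultiples h
      (mem_rightMultiples_trans hxp ⟨r, WithOne.coe_mul _ _⟩))
  obtain ⟨w, hw⟩ := hmin hypT (fun _ h => mem_rightMultiples_trans h hyp)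
    (mem_rightMultiples_self y)
  obtain ⟨n, hn⟩ := hp.1.1.2
  have hpow : ∀ k : ℕ, (y : WithOne X) = y * ((p : WithOne X) * w) ^ k := by
    intro k
    induction k with
    | zero => simp
    | succ k ih => rw [pow_succ', ← mul_assoc, ← mul_assoc, ← WithOne.coe_mul, ← hw, ← ih]
  refine hyJ (hJ.mem_of_mem_rightMultiples hn ⟨w ^ (n + 1) * y, ?_⟩)
  have hcomm : Commute (p : WithOne X) w := WithOne.coe_mul_comm_of_mem_centerSet hp.1.1.1 w
  rw [WithOne.coe_spow, ← mul_assoc, ← hcomm.mul_pow,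
    ← WithOne.coe_mul_comm_of_mem_centerSet hyZ, ← hpow]

end Nil

section CharacterTopology

/-- The subgroup `ℚ/ℤ` of the circle `ℝ/ℤ`. -/
noncomputable def rationalCircleHom : AddCircle (1 : ℚ) →+ UnitAddCircle :=
  QuotientAddGroup.map _ _ (Rat.castHom ℝ).toAddMonoidHom (by simp)

theorem rationalCircleHom_injective : Function.Injective rationalCircleHom := by
  refine (injective_iff_map_eq_zero _).2 fun x hx => ?_
  induction x using QuotientAddGroup.induction_on with
  | H q =>
    obtain ⟨n, hn⟩ := (AddCircle.coe_eq_zero_iff (1 : ℝ) (x := (q : ℝ))).1 hx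
    refine (AddCircle.coe_eq_zero_iff (1 : ℚ)).2 ⟨n, ?_⟩
    rw [zsmul_one] at hn ⊢
    exact_mod_cast hn

/-- The group `ℚ/ℤ` with the topology inherited from the circle `ℝ/ℤ`. -/
abbrev RationalCircle : Type := rationalCircleHom.range

instance : Countable RationalCircle :=
  have : Countable (AddCircle (1 : ℚ)) := Quotient.countable
  rationalCircleHom.rangeRestrict_surjective.countable

theorem exists_rationalCircle_character {A : Type*} [AddCommGroup A] {a : A} (ha : a ≠ 0) :
    ∃ χ : A →+ RationalCircle, χ a ≠ 0 := by
  obtain ⟨c, hc⟩ := CharacterModule.exists_character_apply_ne_zero_of_ne_zero ha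
  refine ⟨rationalCircleHom.rangeRestrict.comp c, fun h => hc ?_⟩
  exact rationalCircleHom_injective ((congrArg Subtype.val h).trans (map_zero _).symm)

/-- The evaluation of characters with values in `ℚ/ℤ`, as a map to a power of the circle. -/
noncomputable def characterEval (A : Type*) [AddCommGroup A] :
    A →+ ((A →+ RationalCircle) → UnitAddCircle) where
  toFun a χ := (χ a : UnitAddCircle)
  map_zero' := by ext; simp
  map_add' a b := by ext; simp

theorem characterEval_injective (A : Type*) [AddCommGroup A] :
    Function.Injective (characterEval A) := by
  refine (injective_iff_map_eq_zero _).2 fun a ha => ?_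
  by_contra hne
  obtain ⟨χ, hχ⟩ := exists_rationalCircle_character hne
  exact hχ (Subtype.ext (congrFun ha χ))

theorem finite_of_discreteTopology_induced_characterEval (A : Type*) [AddCommGroup A]
    (h : @DiscreteTopology A (.induced (characterEval A) inferInstance)) : Finite A := by
  let _ : TopologicalSpace A := .induced (characterEval A) inferInstance
  have hemb : Topology.IsEmbedding (characterEval A) := ⟨⟨rfl⟩, characterEval_injective A⟩
  have hdisc : DiscreteTopology (characterEval A).range :=
    (hemb.toHomeomorph.symm.isEmbedding).discreteTopology
  have hclosed : IsClosed ((characterEval A).range : Set ((A →+ RationalCircle) → UnitAddCircle)) :=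
    AddSubgroup.isClosed_of_discrete
  have hfin := hclosed.isCompact.finite ⟨hdisc⟩
  exact Set.finite_univ_iff.1 (Set.Finite.of_finite_image (f := characterEval A)
    (by rwa [image_univ]) (characterEval_injective A).injOn)

end CharacterTopology

section CenterExtension

open scoped IsMulCommutative

variable (H : Type*) [Group H]

/-- The class of an element modulo the center, with a zero adjoined. -/
noncomputable def centerClass : WithZero H →*₀ WithZero (H ⧸ Subgroup.center H) :=
  WithZero.map' (QuotientGroup.mk' (Subgroup.center H))

variable {H}

/-- The central component of an element, relative to a transversal of the center. -/
noncomputable def centralPart (h : H) : Subgroup.center H :=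
  ⟨(h : H ⧸ Subgroup.center H).out⁻¹ * h, QuotientGroup.eq.1 (QuotientGroup.out_eq' _)⟩

theorem out_mul_centralPart (h : H) : (h : H ⧸ Subgroup.center H).out * centralPart h = h :=
  mul_inv_cancel_left _ _

theorem centralPart_mul_coe (h : H) (z : Subgroup.center H) :
    centralPart (h * z) = centralPart h * z := by
  refine Subtype.ext ?_
  simp only [centralPart, QuotientGroup.mk_mul_of_mem h z.2, Subgroup.coe_mul, mul_assoc]

theorem centralPart_mul (h k : H) : centralPart (h * k) =
    centralPart ((h : H ⧸ Subgroup.center H).out * (k : H ⧸ Subgroup.center H).out) *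
      (centralPart h * centralPart k) := by
  rw [← centralPart_mul_coe]
  congr 1
  have hcomm := Subgroup.mem_center_iff.1 (centralPart h).2 (k : H ⧸ Subgroup.center H).out
  nth_rw 1 [← out_mul_centralPart h, ← out_mul_centralPart k]
  rw [Subgroup.coe_mul, mul_assoc, mul_assoc, ← mul_assoc _ (k : H ⧸ Subgroup.center H).out,
    ← hcomm, mul_assoc]

variable (H) in
/-- The characters of the central component, extended by zero. -/
noncomputable def centralCharacters :
    WithZero H → (Additive (Subgroup.center H) →+ RationalCircle) → RationalCircle :=
  WithZero.recZeroCoe 0 fun h χ => χ (.ofMul (centralPart h))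

variable (H) in
/-- The topology on `H ∪ {0}` in which `0` is isolated and the cosets of the center are open and
carry the topology generated by the characters of the center with values in `ℚ/ℤ`. -/
@[reducible]
noncomputable def centerTopology : TopologicalSpace (WithZero H) :=
  .induced (centerClass H) ⊥ ⊓ .induced (centralCharacters H) inferInstance

theorem finite_center_of_discreteTopology
    (h : @DiscreteTopology (range ((↑) : H → WithZero H)) (@instTopologicalSpaceSubtype _ _
      (centerTopology H))) : Finite (Subgroup.center H) := by
  let _ : TopologicalSpace (WithZero H) := centerTopology H
  let _ : TopologicalSpace (WithZero (H ⧸ Subgroup.center H)) := ⊥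
  let A := Additive (Subgroup.center H)
  let _ : TopologicalSpace A := .induced (characterEval A) inferInstance
  have heval : Continuous (characterEval A) := continuous_induced_dom
  let s : H := (1 : H ⧸ Subgroup.center H).out
  have hs : ∀ z : Subgroup.center H, ((s * z : H) : H ⧸ Subgroup.center H) = s :=
    fun z => QuotientGroup.mk_mul_of_mem s z.2
  let f : A → range ((↑) : H → WithZero H) := fun z => ⟨(s * z.toMul : H), _, rfl⟩
  have hf : Continuous f := by
    refine Continuous.subtype_mk (continuous_inf_rng.2 ⟨continuous_induced_rng.2 ?_,
      continuous_induced_rng.2 ?_⟩) _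
    · convert continuous_const (y := (WithZero.coe (s : H ⧸ Subgroup.center H))) using 1
      ext1 z
      exact congrArg WithZero.coe (hs z.toMul)
    · refine continuous_pi fun χ => ?_
      have : Continuous fun z : A => χ z :=
        Topology.IsInducing.subtypeVal.continuous_iff.2 ((continuous_apply χ).comp heval)
      convert this.const_add (χ (.ofMul (centralPart s))) using 2 with z
      rw [← map_add]
      exact congrArg χ (congrArg Additive.ofMul (centralPart_mul_coe s z.toMul))
  have hinj : Function.Injective f := fun x y hxy => by
    have := mul_left_cancel (WithZero.coe_injective (congrArg Subtype.val hxy))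
    exact Additive.toMul.injective (Subtype.ext this)
  have := finite_of_discreteTopology_induced_characterEval A
    (DiscreteTopology.of_continuous_injective hf hinj)
  exact Finite.of_equiv A Additive.toMul

variable (H) in
theorem isInducing_centerClass_centralCharacters :
    @Topology.IsInducing _ _ (centerTopology H) (@instTopologicalSpaceProd _ _ ⊥ _)
      fun x => (centerClass H x, centralCharacters H x) := by
  let _ : TopologicalSpace (WithZero H) := centerTopology H
  let _ : TopologicalSpace (WithZero (H ⧸ Subgroup.center H)) := ⊥
  refine ⟨?_⟩
  rw [instTopologicalSpaceProd, induced_inf, induced_compose, induced_compose]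
  rfl

theorem centerClass_centralCharacters_injective :
    Function.Injective fun x => (centerClass H x, centralCharacters H x) := by
  intro x y hxy
  obtain ⟨hclass, hchar⟩ := Prod.ext_iff.1 hxy
  dsimp only at hclass hchar
  induction x using WithZero.recZeroCoe with
  | zero =>
    induction y using WithZero.recZeroCoe with
    | zero => rfl
    | coe k => exact absurd hclass.symm WithZero.coe_ne_zero
  | coe h =>
    induction y using WithZero.recZeroCoe with
    | zero => exact absurd hclass WithZero.coe_ne_zero
    | coe k =>
      have hq : (h : H ⧸ Subgroup.center H) = k := WithZero.coe_injective hclass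
      have hz : centralPart h = centralPart k := by
        refine Additive.ofMul.injective (sub_eq_zero.1 ?_)
        by_contra hne
        obtain ⟨χ, hχ⟩ := exists_rationalCircle_character hne
        exact hχ ((map_sub χ _ _).trans (sub_eq_zero.2 (congrFun hchar χ)))
      rw [← out_mul_centralPart h, ← out_mul_centralPart k, hq, hz]

theorem hasClopenBasis_centerTopology : @HasClopenBasis (WithZero H) (centerTopology H) := by
  let _ : TopologicalSpace (WithZero H) := centerTopology H
  let _ : TopologicalSpace (WithZero (H ⧸ Subgroup.center H)) := ⊥
  have _ : DiscreteTopology (WithZero (H ⧸ Subgroup.center H)) := ⟨rfl⟩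
  exact ((hasClopenBasis_of_discrete _).prod (HasClopenBasis.pi fun _ =>
    hasClopenBasis_of_countable RationalCircle)).of_isInducing
      (isInducing_centerClass_centralCharacters H)

theorem t1Space_centerTopology : @T1Space (WithZero H) (centerTopology H) := by
  let _ : TopologicalSpace (WithZero H) := centerTopology H
  let _ : TopologicalSpace (WithZero (H ⧸ Subgroup.center H)) := ⊥
  have _ : DiscreteTopology (WithZero (H ⧸ Subgroup.center H)) := ⟨rfl⟩
  exact Topology.IsEmbedding.t1Space ⟨isInducing_centerClass_centralCharacters H,
    centerClass_centralCharacters_injective⟩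

theorem continuousMul_centerTopology : @ContinuousMul (WithZero H) (centerTopology H) _ := by
  let _ : TopologicalSpace (WithZero H) := centerTopology H
  let D := WithZero (H ⧸ Subgroup.center H)
  let _ : TopologicalSpace D := ⊥
  have _ : DiscreteTopology D := ⟨rfl⟩
  have hclass : Continuous (centerClass H) := continuous_iff_le_induced.2 inf_le_left
  have hchar : Continuous (centralCharacters H) := continuous_iff_le_induced.2 inf_le_right
  refine ⟨continuous_inf_rng.2 ⟨continuous_induced_rng.2 ?_, continuous_induced_rng.2 ?_⟩⟩
  · have hmul : Continuous fun p : D × D => p.1 * p.2 := continuous_of_discreteTopology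
    convert hmul.comp ((hclass.comp continuous_fst).prodMk (hclass.comp continuous_snd)) using 1
    exact funext fun p => map_mul (centerClass H) p.1 p.2
  · refine continuous_pi fun χ => ?_
    let F : (D × D) × (RationalCircle × RationalCircle) → RationalCircle := fun p =>
      WithZero.recZeroCoe 0 (fun q => WithZero.recZeroCoe 0 (fun r =>
        χ (.ofMul (centralPart (q.out * r.out))) + (p.2.1 + p.2.2)) p.1.2) p.1.1
    have hF : Continuous F := by
      refine continuous_prod_of_discrete_left.2 ?_
      rintro ⟨a, b⟩
      induction a using WithZero.recZeroCoe with
      | zero => exact continuous_const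
      | coe q =>
        induction b using WithZero.recZeroCoe with
        | zero => exact continuous_const
        | coe r => exact continuous_const.add (continuous_fst.add continuous_snd)
    have hχ := (continuous_apply χ).comp hchar
    convert hF.comp (((hclass.comp continuous_fst).prodMk (hclass.comp continuous_snd)).prodMk
      ((hχ.comp continuous_fst).prodMk (hχ.comp continuous_snd))) using 2 with p
    obtain ⟨x, y⟩ := p
    induction x using WithZero.recZeroCoe with
    | zero => exact congrFun (congrArg (centralCharacters H) (zero_mul y)) χ
    | coe h =>
      induction y using WithZero.recZeroCoe with
      | zero => exact congrFun (congrArg (centralCharacters H) (mul_zero (h : WithZero H))) χ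
      | coe k =>
        refine (congrArg (fun z => χ (.ofMul z)) (centralPart_mul h k)).trans ?_
        rw [ofMul_mul, map_add, ofMul_mul, map_add]
        rfl

end CenterExtension

section ViableIdempotents

variable {X : Type u} [Semigroup X] {e : X}

theorem self_mem_maxSubgroup (he : e ∈ idemSet X) : e ∈ maxSubgroup X e :=
  ⟨he, he, e, he, he, he, he⟩

theorem mul_mem_maxSubgroup {x y : X} (hx : x ∈ maxSubgroup X e) (hy : y ∈ maxSubgroup X e) :
    x * y ∈ maxSubgroup X e := by
  obtain ⟨hxe, hex, x', hx'e, hex', hxx', hx'x⟩ := hx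
  obtain ⟨hye, hey, y', hy'e, hey', hyy', hy'y⟩ := hy
  refine ⟨by rw [mul_assoc, hye], by rw [← mul_assoc, hex], y' * x', by rw [mul_assoc, hx'e],
    by rw [← mul_assoc, hey'], ?_, ?_⟩
  · rw [mul_assoc, ← mul_assoc y, hyy', hex', hxx']
  · rw [mul_assoc, ← mul_assoc x', hx'x, hey, hy'y]

/-- The group structure of the maximal subgroup of an idempotent. -/
@[reducible]
noncomputable def maxSubgroupGroup (he : e ∈ idemSet X) : Group (maxSubgroup X e) :=
  let _ : Mul (maxSubgroup X e) := ⟨fun x y => ⟨x * y, mul_mem_maxSubgroup x.2 y.2⟩⟩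
  let _ : One (maxSubgroup X e) := ⟨⟨e, self_mem_maxSubgroup he⟩⟩
  let _ : Inv (maxSubgroup X e) := ⟨fun x => ⟨x.2.2.2.choose,
    x.2.2.2.choose_spec.1, x.2.2.2.choose_spec.2.1, x, x.2.1, x.2.2.1,
    x.2.2.2.choose_spec.2.2.2, x.2.2.2.choose_spec.2.2.1⟩⟩
  Group.ofLeftAxioms (fun x y z => Subtype.ext (mul_assoc (x : X) y z))
    (fun x => Subtype.ext x.2.2.1) (fun x => Subtype.ext x.2.2.2.choose_spec.2.2.2)

theorem self_mem_HeCoideal (he : e ∈ idemSet X) : e ∈ HeCoideal X e :=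
  ⟨rfl, (show e * e = e from he).symm ▸ self_mem_maxSubgroup he⟩

theorem HeCoideal.mul_mul_eq {x y : X} (hy : y ∈ HeCoideal X e) :
    x * y * e = x * e * (y * e) := by
  obtain ⟨hye, -, hey, -⟩ := hy
  rw [mul_assoc x e, hey, mul_assoc]

theorem HeCoideal.mul_mem {x y : X} (hx : x ∈ HeCoideal X e) (hy : y ∈ HeCoideal X e) :
    x * y ∈ HeCoideal X e := by
  refine ⟨?_, HeCoideal.mul_mul_eq hy ▸ mul_mem_maxSubgroup hx.2 hy.2⟩
  rw [mul_assoc, hy.1, ← mul_assoc, hx.1, mul_assoc]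

theorem mul_mem_HeCoideal_iff (he : e ∈ viableIdems X) {x y : X} :
    x * y ∈ HeCoideal X e ↔ x ∈ HeCoideal X e ∧ y ∈ HeCoideal X e := by
  refine ⟨fun h => ⟨?_, ?_⟩, fun h => HeCoideal.mul_mem h.1 h.2⟩ <;> by_contra hn
  · exact ((he.2 x ⟨trivial, hn⟩ y).1).2 h
  · exact ((he.2 y ⟨trivial, hn⟩ x).2).2 h

theorem maxSubgroup_subset_HeCoideal : maxSubgroup X e ⊆ HeCoideal X e :=
  fun _ hx => ⟨hx.1.trans hx.2.1.symm, hx.1.symm ▸ hx⟩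

open scoped Classical in
/-- The homomorphism of `X` onto the maximal subgroup of a viable idempotent with zero adjoined
which sends the complement of the coideal to zero. -/
noncomputable def viableHom (he : e ∈ viableIdems X) :
    let _ := maxSubgroupGroup he.1
    X →ₙ* WithZero (maxSubgroup X e) :=
  let _ := maxSubgroupGroup he.1
  { toFun := fun x => if h : x ∈ HeCoideal X e then
      WithZero.coe (⟨x * e, h.2⟩ : maxSubgroup X e) else 0
    map_mul' := by
      intro x y
      by_cases hx : x ∈ HeCoideal X e
      · by_cases hy : y ∈ HeCoideal X e
        · rw [dif_pos hx, dif_pos hy, dif_pos (HeCoideal.mul_mem hx hy), ← WithZero.coe_mul]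
          exact congrArg WithZero.coe (Subtype.ext (HeCoideal.mul_mul_eq hy))
        · rw [dif_neg hy, mul_zero, dif_neg fun h => hy ((mul_mem_HeCoideal_iff he).1 h).2]
      · rw [dif_neg hx, zero_mul, dif_neg fun h => hx ((mul_mem_HeCoideal_iff he).1 h).1] }

theorem HasClosedDiscreteImages.finite_maxSubgroup_inter_centerSet
    (hX : HasClosedDiscreteImages X) (he : e ∈ viableIdems X) :
    (maxSubgroup X e ∩ centerSet X).Finite := by
  let _ := maxSubgroupGroup he.1
  let H := maxSubgroup X e
  let _ : TopologicalSpace (WithZero H) := centerTopology H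
  have _ : ContinuousMul (WithZero H) := continuousMul_centerTopology
  have _ : T1Space (WithZero H) := t1Space_centerTopology
  have hdisc := (hX (WithZero H) hasClopenBasis_centerTopology (viableHom he)).2
  have hsub : range ((↑) : H → WithZero H) ⊆ range (viableHom he) := by
    rintro _ ⟨x, rfl⟩
    refine ⟨x, (dif_pos (maxSubgroup_subset_HeCoideal x.2)).trans ?_⟩
    exact congrArg WithZero.coe (Subtype.ext x.2.1)
  have := finite_center_of_discreteTopology (H := H) (DiscreteTopology.of_subset hdisc hsub)
  refine ((toFinite (Subgroup.center H : Set H)).image Subtype.val).subset ?_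
  rintro x ⟨hxH, hxZ⟩
  exact ⟨⟨x, hxH⟩, Subgroup.mem_center_iff.2 fun y => Subtype.ext (hxZ y).symm, rfl⟩

open scoped Classical in
theorem HasClosedDiscreteImages.finite_viableIdems_inter_centerSet
    (hX : HasClosedDiscreteImages X) : (viableIdems X ∩ centerSet X).Finite := by
  let E := (viableIdems X ∩ centerSet X : Set X)
  let h : X →ₙ* (E → ZMod 2) :=
    { toFun := fun x e => if x ∈ HeCoideal X (e : X) then 1 else 0
      map_mul' := by
        intro x y
        ext1 e
        by_cases hx : x ∈ HeCoideal X (e : X) <;> by_cases hy : y ∈ HeCoideal X (e : X) <;>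
          simp [mul_mem_HeCoideal_iff e.2.1, hx, hy] }
  obtain ⟨hclosed, hdisc⟩ := hX (E → ZMod 2)
    (HasClopenBasis.pi fun _ => hasClopenBasis_of_discrete (ZMod 2)) h
  have hfin := hclosed.isCompact.finite ⟨hdisc⟩
  have hmem : ∀ e f : E, h e = h f → (f : X) * e = e := by
    intro e f hef
    have hfe : (f : X) ∈ HeCoideal X (e : X) := by
      by_contra hn
      have := congrFun hef e
      simp [h, self_mem_HeCoideal e.2.1.1, hn] at this
    obtain ⟨hxe, hex, y, hye, hey, hxy, hyx⟩ := hfe.2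
    have hff : (f : X) * f = f := f.2.1.1
    have hidem : (f : X) * e * (f * e) = f * e := by
      rw [← HeCoideal.mul_mul_eq hfe, hff]
    calc (f : X) * e = e * (f * e) := hex.symm
      _ = y * (f * e * (f * e)) := by rw [← mul_assoc y, hyx]
      _ = e := by rw [hidem, hyx]
  refine Set.Finite.of_finite_image (f := h) (hfin.subset (image_subset_range _ _)) ?_
  intro e he f hf hef
  have h1 := hmem ⟨e, he⟩ ⟨f, hf⟩ hef
  have h2 := hmem ⟨f, hf⟩ ⟨e, he⟩ hef.symm
  exact (h1.symm.trans (hf.2 e)).trans h2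

theorem isIdealSet_compl_HeCoideal_union_maxSubgroup (he : e ∈ viableIdems X) :
    IsIdealSet X ((univ \ HeCoideal X e) ∪ maxSubgroup X e) := by
  rintro x (hx | hx) y
  · exact ⟨Or.inl (he.2 x hx y).1, Or.inl (he.2 x hx y).2⟩
  · by_cases hy : y ∈ HeCoideal X e
    · have hxy : x * y = x * (y * e) := by rw [hy.1, ← mul_assoc, hx.1]
      have hyx : y * x = y * e * x := by rw [mul_assoc, hx.2.1]
      exact ⟨Or.inr (hxy ▸ mul_mem_maxSubgroup hx hy.2),
        Or.inr (hyx ▸ mul_mem_maxSubgroup hy.2 hx)⟩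
    · exact ⟨Or.inl (he.2 y ⟨trivial, hy⟩ x).2, Or.inl (he.2 y ⟨trivial, hy⟩ x).1⟩

theorem IsIdealSet.spow_mem {I : Set X} (hI : IsIdealSet X I) {x : X} (hx : x ∈ I) (n : ℕ) :
    spow x n ∈ I := by
  cases n with
  | zero => exact hx
  | succ n => exact (hI x hx _).2

theorem spow_mem_centerSet {z : X} (hz : z ∈ centerSet X) (n : ℕ) : spow z n ∈ centerSet X := by
  induction n with
  | zero => exact hz
  | succ n ih => exact centerSet_mul_mem ih hz

theorem HasClosedDiscreteImages.finite_centerSet_inter_sqrtSet_singleton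
    (hX : HasClosedDiscreteImages X) (he : e ∈ viableIdems X) :
    (centerSet X ∩ sqrtSet X {e}).Finite := by
  refine ((hX.finite_maxSubgroup_inter_centerSet he).union (hX.finite_central_radical_diff
    (isIdealSet_compl_HeCoideal_union_maxSubgroup he))).subset ?_
  rintro z ⟨hz, n, hn⟩
  have hn : spow z n = e := hn
  by_cases hzJ : z ∈ (univ \ HeCoideal X e) ∪ maxSubgroup X e
  · rcases hzJ with hzI | hzH
    · exact absurd (self_mem_HeCoideal he.1) (hn ▸ he.2.spow_mem hzI n).2
    · exact Or.inl ⟨hzH, hz⟩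
  · exact Or.inr ⟨⟨hz, n, Or.inr (hn.symm ▸ self_mem_maxSubgroup he.1)⟩, hzJ⟩

end ViableIdempotents

theorem statement7 (X : Type u) [Semigroup X]
    (h1 : ProjectivelyTzSClosed X) (h2 : ProjectivelyTzSDiscrete X) :
    (∀ z ∈ centerSet X, ∃ n : ℕ, spow z n ∈ idemSet X) ∧
      (centerSet X ∩ sqrtSet X (viableIdems X)).Finite := by
  have hX := hasClosedDiscreteImages_of_projectively h1 h2
  refine ⟨fun z hz => hX.exists_spow_mem_idemSet hz, ?_⟩
  refine (hX.finite_viableIdems_inter_centerSet.biUnion fun e he =>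
    hX.finite_centerSet_inter_sqrtSet_singleton he.1).subset ?_
  rintro z ⟨hz, n, hn⟩
  exact mem_biUnion (x := spow z n) ⟨hn, spow_mem_centerSet hz n⟩ ⟨hz, n, rfl⟩
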